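/- Let k be an infinite field and R = k[x,y] with homogeneous maximal ideal 𝔪 = (x,y). Let I and J be nonzero proper homogeneous full ideals of R and assume μ(I + J) = μ(I) + μ(J). Then I + J is full if and only if o(I ∩ J) ≤ max{o(I), o(J)} + 1. -/

import Mathlib

open MvPolynomial

noncomputable section

variable {k : Type*} [Field k]

/-- An ideal of a polynomial ring is homogeneous if it contains all homogeneous
components of its elements. -/
def IsHomogeneousIdeal {σ : Type*} (I : Ideal (MvPolynomial σ k)) : Prop :=
  ∀ p ∈ I, ∀ d : ℕ, MvPolynomial.homogeneousComponent d p ∈ I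

/-- The homogeneous maximal ideal `(x, y)` of `k[x,y]`. -/
def maxIdeal (k : Type*) [Field k] : Ideal (MvPolynomial (Fin 2) k) :=
  Ideal.span {X 0, X 1}

/-- A homogeneous ideal `I ⊆ k[x,y]` is full if `(I : z) = (I : 𝔪)` for some
linear form `z`. -/
def IsFull (I : Ideal (MvPolynomial (Fin 2) k)) : Prop :=
  ∃ z : MvPolynomial (Fin 2) k, z ≠ 0 ∧ z.IsHomogeneous 1 ∧
    Submodule.colon I (Ideal.span {z}) = Submodule.colon I (maxIdeal k)

/-- The order `o(I)` of an ideal: the smallest degree of a nonzero homogeneous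
element of `I`. -/
def ordDeg (I : Ideal (MvPolynomial (Fin 2) k)) : ℕ :=
  sInf {d : ℕ | ∃ p ∈ I, p ≠ 0 ∧ MvPolynomial.IsHomogeneous p d}

/-- The minimal number of generators of an ideal. -/
def mu (I : Ideal (MvPolynomial (Fin 2) k)) : ℕ :=
  sInf {n : ℕ | ∃ s : Finset (MvPolynomial (Fin 2) k), s.card = n ∧
    Ideal.span (s : Set (MvPolynomial (Fin 2) k)) = I}



/-- Multiplying by a linear form shifts homogeneous components. -/
lemma hc_mul {z v : MvPolynomial (Fin 2) k} (hz : z.IsHomogeneous 1) (n : ℕ) :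
    homogeneousComponent (n + 1) (z * v) = z * homogeneousComponent n v := by
  conv_lhs => rw [← sum_homogeneousComponent v, Finset.mul_sum, map_sum]
  have h : ∀ i, homogeneousComponent (n + 1) (z * homogeneousComponent i v)
      = if i = n then z * homogeneousComponent n v else 0 := by
    intro i
    have := hz.mul (homogeneousComponent_isHomogeneous i v)
    rw [homogeneousComponent_of_mem ((mem_homogeneousSubmodule _ _).2 this)]
    by_cases hi : i = n
    · subst hi; simp [add_comm]
    · rw [if_neg (by omega), if_neg hi]
  simp only [h, Finset.sum_ite_eq', Finset.mem_range]
  split_ifs with hn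
  · rfl
  · rw [homogeneousComponent_eq_zero _ _ (by omega), mul_zero]

lemma hc_mul_zero {z v : MvPolynomial (Fin 2) k} (hz : z.IsHomogeneous 1) :
    homogeneousComponent 0 (z * v) = 0 := by
  have := hz.coeff_eq_zero (d := 0) (by simp)
  rw [homogeneousComponent_zero, ← constantCoeff_eq, map_mul, constantCoeff_eq, this]
  simp

lemma hc_self {p : MvPolynomial (Fin 2) k} {n : ℕ} (hp : p.IsHomogeneous n) :
    homogeneousComponent n p = p := homogeneousComponent_eq_self hp

/-- the linear form `a x + b y` -/
def lin (a b : k) : MvPolynomial (Fin 2) k := C a * X 0 + C b * X 1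

lemma lin_hom (a b : k) : (lin a b).IsHomogeneous 1 :=
  (isHomogeneous_C_mul_X _ _).add (isHomogeneous_C_mul_X _ _)

lemma exists_lin {z : MvPolynomial (Fin 2) k} (hz : z.IsHomogeneous 1) : ∃ a b, z = lin a b := by
  have h : z ∈ homogeneousSubmodule (Fin 2) k 1 := hz
  rw [homogeneousSubmodule_one_eq_span_X, Submodule.mem_span_range_iff_exists_fun] at h
  obtain ⟨c, hc⟩ := h
  refine ⟨c 0, c 1, ?_⟩
  rw [← hc, Fin.sum_univ_two, lin, smul_eq_C_mul, smul_eq_C_mul]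

lemma exists_dual {a b : k} (h : a ≠ 0 ∨ b ≠ 0) : ∃ c d, a * c + b * d = 1 := by
  rcases h with h | h
  · exact ⟨a⁻¹, 0, by simp [h]⟩
  · exact ⟨0, b⁻¹, by simp [h]⟩

variable {a b c d : k}

/-- `x` and `y` in terms of `z = b x - a y` and `t = c x + d y`. -/
lemma X0_eq (h : a * c + b * d = 1) :
    (X 0 : MvPolynomial (Fin 2) k) = C a * lin c d + C d * lin b (-a) := by
  have h' : (C a * C c + C b * C d : MvPolynomial (Fin 2) k) = 1 := by
    rw [← C_mul, ← C_mul, ← C_add, h, C_1]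
  simp only [lin, C_neg]
  linear_combination (-X 0) * h'

lemma X1_eq (h : a * c + b * d = 1) :
    (X 1 : MvPolynomial (Fin 2) k) = C b * lin c d - C c * lin b (-a) := by
  have h' : (C a * C c + C b * C d : MvPolynomial (Fin 2) k) = 1 := by
    rw [← C_mul, ← C_mul, ← C_add, h, C_1]
  simp only [lin, C_neg]
  linear_combination (-X 1) * h'

lemma eval_lin (P : Fin 2 → k) : eval P (lin c d) = c * P 0 + d * P 1 := by
  simp [lin]

/-- A form vanishing at `(a,b)` is divisible by `z = b x - a y`. -/
lemma dvd_of_eval (h : a * c + b * d = 1) {u : MvPolynomial (Fin 2) k} {n : ℕ} (hu : u.IsHomogeneous n)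
    (h0 : eval ![a, b] u = 0) : lin b (-a) ∣ u := by
  rw [← Ideal.mem_span_singleton, ← Ideal.Quotient.eq_zero_iff_mem]
  set q := Ideal.Quotient.mkₐ k (Ideal.span {lin b (-a)}) with hq
  have hz : q (lin b (-a)) = 0 :=
    Ideal.Quotient.eq_zero_iff_mem.2 (Ideal.mem_span_singleton_self _)
  have hC : ∀ r : k, q (C r) = algebraMap k _ r := fun r => q.commutes r
  have e0 : q (X 0) = algebraMap k _ a * q (lin c d) := by
    conv_lhs => rw [X0_eq h]
    rw [map_add, map_mul, map_mul, hz, mul_zero, add_zero, hC]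
  have e1 : q (X 1) = algebraMap k _ b * q (lin c d) := by
    conv_lhs => rw [X1_eq h]
    rw [map_sub, map_mul, map_mul, hz, mul_zero, sub_zero, hC]
  change q u = 0
  have key : q u = algebraMap k _ (eval ![a, b] u) * q (lin c d) ^ n := by
    conv_lhs => rw [u.as_sum]
    rw [eval_eq', map_sum, map_sum, Finset.sum_mul]
    refine Finset.sum_congr rfl fun s hs => ?_
    have hs' := hu.degree_eq_sum_deg_support hs
    rw [monomial_eq, map_mul, hC, Finsupp.prod_fintype _ _ (by simp), Fin.prod_univ_two,
      Fin.prod_univ_two, map_mul, map_pow, map_pow, e0, e1]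
    have : n = s 0 + s 1 := by
      rw [hs', ← Fin.sum_univ_two]
      exact Finset.sum_subset (Finset.subset_univ _) (by simp)
    rw [this]
    simp only [map_mul, map_pow, Matrix.cons_val_zero, Matrix.cons_val_one]
    ring
  rw [key, h0, map_zero, zero_mul]

lemma exists_factor (h : a * c + b * d = 1) {u : MvPolynomial (Fin 2) k} {n : ℕ} (hu : u.IsHomogeneous (n + 1))
    (h0 : eval ![a, b] u = 0) : ∃ w : MvPolynomial (Fin 2) k, w.IsHomogeneous n ∧ u = lin b (-a) * w := by
  obtain ⟨w, hw⟩ := dvd_of_eval h hu h0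
  refine ⟨homogeneousComponent n w, homogeneousComponent_isHomogeneous _ _, ?_⟩
  rw [← hc_mul (lin_hom _ _), ← hw, hc_self hu]

lemma eval_z : eval ![a, b] (lin b (-a)) = 0 := by
  rw [eval_lin]; simp; ring

lemma eval_t (h : a * c + b * d = 1) : eval ![a, b] (lin c d) = 1 := by
  rw [eval_lin, ← h]; simp; ring

lemma z_ne (h : a * c + b * d = 1) : lin b (-a) ≠ 0 := by
  intro h0
  have h1 := eval_lin (c := b) (d := -a) ![d, -c]
  rw [h0] at h1
  simp at h1
  have : (1 : k) = 0 := by rw [← h]; linear_combination -h1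
  exact one_ne_zero this

/-- The degree `n` part of an ideal. -/
def gr (K : Ideal (MvPolynomial (Fin 2) k)) (n : ℕ) : Submodule k (MvPolynomial (Fin 2) k) :=
  K.restrictScalars k ⊓ homogeneousSubmodule (Fin 2) k n

lemma mem_gr {K : Ideal (MvPolynomial (Fin 2) k)} {n : ℕ} {p : MvPolynomial (Fin 2) k} :
    p ∈ gr K n ↔ p ∈ K ∧ p.IsHomogeneous n := Iff.rfl

instance (K : Ideal (MvPolynomial (Fin 2) k)) (n : ℕ) : FiniteDimensional k (gr K n) := by
  have : FiniteDimensional k (homogeneousSubmodule (Fin 2) k n) :=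
    Module.Finite.iff_fg.2 (homogeneousSubmodule_fg (σ := Fin 2) (R := k) n)
  exact Submodule.finiteDimensional_of_le (inf_le_right)

/-- multiplication of a subspace by a polynomial -/
def mulBy (z : MvPolynomial (Fin 2) k) (V : Submodule k (MvPolynomial (Fin 2) k)) : Submodule k (MvPolynomial (Fin 2) k) :=
  V.map (LinearMap.mulLeft k z)

lemma mem_mulBy {z p : MvPolynomial (Fin 2) k} {V : Submodule k (MvPolynomial (Fin 2) k)} :
    p ∈ mulBy z V ↔ ∃ v ∈ V, z * v = p := Iff.rfl

/-- `x V + y V` -/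
def mm (V : Submodule k (MvPolynomial (Fin 2) k)) : Submodule k (MvPolynomial (Fin 2) k) := mulBy (X 0) V ⊔ mulBy (X 1) V

lemma mem_mm {p : MvPolynomial (Fin 2) k} {V : Submodule k (MvPolynomial (Fin 2) k)} :
    p ∈ mm V ↔ ∃ v ∈ V, ∃ w ∈ V, X 0 * v + X 1 * w = p := by
  rw [mm, Submodule.mem_sup]
  constructor
  · rintro ⟨_, ⟨v, hv, rfl⟩, _, ⟨w, hw, rfl⟩, rfl⟩
    exact ⟨v, hv, w, hw, rfl⟩
  · rintro ⟨v, hv, w, hw, rfl⟩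
    exact ⟨_, ⟨v, hv, rfl⟩, _, ⟨w, hw, rfl⟩, rfl⟩

instance (z : MvPolynomial (Fin 2) k) (V : Submodule k (MvPolynomial (Fin 2) k)) [FiniteDimensional k V] :
    FiniteDimensional k (mulBy z V) := by unfold mulBy; infer_instance

instance (V : Submodule k (MvPolynomial (Fin 2) k)) [FiniteDimensional k V] :
    FiniteDimensional k (mm V) := by unfold mm; infer_instance

lemma lin_mul_mem (c d : k) {V : Submodule k (MvPolynomial (Fin 2) k)} {v : MvPolynomial (Fin 2) k} (hv : v ∈ V) :
    lin c d * v ∈ mm V := by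
  rw [mem_mm]
  refine ⟨c • v, V.smul_mem _ hv, d • v, V.smul_mem _ hv, ?_⟩
  rw [lin, smul_eq_C_mul, smul_eq_C_mul]; ring

lemma mm_sup (V W : Submodule k (MvPolynomial (Fin 2) k)) : mm (V ⊔ W) = mm V ⊔ mm W := by
  simp only [mm, mulBy, Submodule.map_sup]
  ac_rfl

lemma mm_bot : mm (⊥ : Submodule k (MvPolynomial (Fin 2) k)) = ⊥ := by
  simp [mm, mulBy]

lemma mm_gr_le (K : Ideal (MvPolynomial (Fin 2) k)) (n : ℕ) : mm (gr K n) ≤ gr K (n + 1) := by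
  intro p hp
  rw [mem_mm] at hp
  obtain ⟨v, hv, w, hw, rfl⟩ := hp
  rw [mem_gr] at *
  refine ⟨K.add_mem (K.mul_mem_left _ hv.1) (K.mul_mem_left _ hw.1), ?_⟩
  rw [add_comm n]
  exact ((isHomogeneous_X _ _).mul hv.2).add ((isHomogeneous_X _ _).mul hw.2)

/-- the dimension of `z V + k u` -/
lemma finrank_zu (h : a * c + b * d = 1) (V : Submodule k (MvPolynomial (Fin 2) k)) [FiniteDimensional k V]
    {u : MvPolynomial (Fin 2) k} (hu : eval ![a, b] u ≠ 0) :
    Module.finrank k ↥(mulBy (lin b (-a)) V ⊔ Submodule.span k {u}) =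
      Module.finrank k V + 1 := by
  have hu0 : u ≠ 0 := by rintro rfl; simp at hu
  have hinj : Function.Injective (LinearMap.mulLeft k (lin b (-a))) := by
    intro p q hpq
    exact mul_left_cancel₀ (z_ne h) hpq
  have h1 : Module.finrank k (mulBy (lin b (-a)) V) = Module.finrank k V :=
    (Submodule.equivMapOfInjective _ hinj V).finrank_eq.symm
  have h2 := Submodule.finrank_sup_add_finrank_inf_eq (mulBy (lin b (-a)) V)
    (Submodule.span k {u})
  have h3 : mulBy (lin b (-a)) V ⊓ Submodule.span k {u} = ⊥ := by
    rw [eq_bot_iff]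
    rintro p ⟨⟨v, hv, hvp⟩, hp⟩
    obtain ⟨r, rfl⟩ := Submodule.mem_span_singleton.1 hp
    have := congrArg (eval ![a, b]) hvp
    rw [LinearMap.mulLeft_apply, map_mul, eval_z, zero_mul, smul_eval] at this
    have hr : r = 0 := by
      rcases mul_eq_zero.1 this.symm with h | h
      · exact h
      · exact absurd h hu
    simp [hr]
  rw [h3, finrank_bot, add_zero, finrank_span_singleton hu0, h1] at h2
  exact h2

lemma zu_le (V : Submodule k (MvPolynomial (Fin 2) k)) {p : MvPolynomial (Fin 2) k} (hp : p ∈ V) :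
    mulBy (lin b (-a)) V ⊔ Submodule.span k {lin c d * p} ≤ mm V := by
  refine sup_le ?_ ?_
  · rintro _ ⟨v, hv, rfl⟩
    exact lin_mul_mem _ _ hv
  · rw [Submodule.span_singleton_le_iff_mem]
    exact lin_mul_mem _ _ hp

lemma exists_pt [Infinite k] {p : MvPolynomial (Fin 2) k} (hp : p ≠ 0) :
    ∃ a b c d : k, a * c + b * d = 1 ∧ eval ![a, b] p ≠ 0 := by
  have : ∃ P : Fin 2 → k, eval P (X 0 * p) ≠ 0 := by
    by_contra! hcon
    exact mul_ne_zero (X_ne_zero _) hp (MvPolynomial.funext fun P => by rw [hcon P, map_zero])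
  obtain ⟨P, hP⟩ := this
  rw [map_mul, eval_X] at hP
  obtain ⟨c, d, h⟩ := exists_dual (a := P 0) (b := P 1) (Or.inl (left_ne_zero_of_mul hP))
  refine ⟨P 0, P 1, c, d, h, ?_⟩
  have : ![P 0, P 1] = P := by ext i; fin_cases i <;> rfl
  rw [this]
  exact right_ne_zero_of_mul hP

lemma growth [Infinite k] (V : Submodule k (MvPolynomial (Fin 2) k)) [FiniteDimensional k V] (hV : V ≠ ⊥) :
    Module.finrank k V + 1 ≤ Module.finrank k (mm V) := by
  obtain ⟨p, hp, hp0⟩ := Submodule.exists_mem_ne_zero_of_ne_bot hV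
  obtain ⟨a, b, c, d, h, he⟩ := exists_pt hp0
  rw [← finrank_zu h V (u := lin c d * p) (by rw [map_mul, eval_t h, one_mul]; exact he)]
  exact Submodule.finrank_mono (zu_le V hp)

lemma isFull_iff (K : Ideal (MvPolynomial (Fin 2) k)) : IsFull K ↔ ∃ z : MvPolynomial (Fin 2) k, z ≠ 0 ∧ z.IsHomogeneous 1 ∧
    ∀ v, z * v ∈ K → X 0 * v ∈ K ∧ X 1 * v ∈ K := by
  have h1 : ∀ z v : MvPolynomial (Fin 2) k, v ∈ Submodule.colon K (Ideal.span {z} : Ideal (MvPolynomial (Fin 2) k)) ↔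
      z * v ∈ K := by
    intro z v
    rw [Submodule.mem_colon]
    constructor
    · intro h
      have := h z (Ideal.mem_span_singleton_self z)
      rwa [smul_eq_mul, mul_comm] at this
    · intro h s hs
      obtain ⟨w, rfl⟩ := Ideal.mem_span_singleton'.1 hs
      have := K.mul_mem_left w h
      rw [smul_eq_mul]
      convert this using 1
      ring
  have h2 : ∀ v : MvPolynomial (Fin 2) k, v ∈ Submodule.colon K (maxIdeal k) ↔
      X 0 * v ∈ K ∧ X 1 * v ∈ K := by
    intro v
    rw [Submodule.mem_colon]
    constructor
    · intro h
      have h0 := h (X 0) (Ideal.subset_span (by simp))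
      have h1 := h (X 1) (Ideal.subset_span (by simp))
      rw [smul_eq_mul, mul_comm] at h0 h1
      exact ⟨h0, h1⟩
    · rintro ⟨h0, h1⟩ s hs
      obtain ⟨p, q, rfl⟩ := Ideal.mem_span_pair.1 hs
      have := K.add_mem (K.mul_mem_left p h0) (K.mul_mem_left q h1)
      rw [smul_eq_mul]
      convert this using 1
      ring
  unfold IsFull
  refine exists_congr fun z => and_congr_right fun _ => and_congr_right fun hz => ?_
  constructor
  · intro h v hv
    rw [← h2, ← h, h1]
    exact hv
  · intro h
    ext v
    rw [h1, h2]
    refine ⟨h v, ?_⟩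
    rintro ⟨h0, h1⟩
    obtain ⟨a, b, rfl⟩ := exists_lin hz
    have := K.add_mem (K.mul_mem_left (C a) h0) (K.mul_mem_left (C b) h1)
    rw [lin]
    convert this using 1
    ring

/-- numerical property equivalent to fullness -/
def NumFull (K : Ideal (MvPolynomial (Fin 2) k)) : Prop :=
  ∀ n, gr K n ≠ ⊥ → Module.finrank k (mm (gr K n)) = Module.finrank k (gr K n) + 1

lemma eval_ne_of_zero {q : MvPolynomial (Fin 2) k} (hq : q.IsHomogeneous 0) (h0 : q ≠ 0) (P : Fin 2 → k) :
    eval P q ≠ 0 := by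
  have : q.totalDegree = 0 := hq.totalDegree h0
  rw [totalDegree_eq_zero_iff_eq_C] at this
  rw [this] at h0 ⊢
  rw [eval_C]
  intro h
  rw [h] at h0
  simp at h0

lemma exists_nonvanishing (h : a * c + b * d = 1) (K : Ideal (MvPolynomial (Fin 2) k))
    (hK : ∀ v, lin b (-a) * v ∈ K → lin c d * v ∈ K) (n : ℕ) :
    ∀ (i : ℕ) (q : MvPolynomial (Fin 2) k), q ≠ 0 → q.IsHomogeneous n → lin c d ^ i * q ∈ K →
      ∃ p ∈ gr K (n + i), eval ![a, b] p ≠ 0 := by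
  have main : ∀ (n i : ℕ) (q : MvPolynomial (Fin 2) k), q.IsHomogeneous n → lin c d ^ i * q ∈ K →
      eval ![a, b] q ≠ 0 → ∃ p ∈ gr K (n + i), eval ![a, b] p ≠ 0 := by
    intro n i q hq hm he
    refine ⟨_, ⟨hm, ?_⟩, ?_⟩
    · have := ((lin_hom c d).pow i).mul hq
      rwa [one_mul, add_comm] at this
    · rwa [map_mul, map_pow, eval_t h, one_pow, one_mul]
  induction n with
  | zero =>
    intro i q hq hh hm
    exact main 0 i q hh hm (eval_ne_of_zero hh hq _)
  | succ n ih =>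
    intro i q hq hh hm
    by_cases he : eval ![a, b] q = 0
    · obtain ⟨w, hw, rfl⟩ := exists_factor h hh he
      have := ih (i + 1) w (right_ne_zero_of_mul hq) hw (by
        have := hK (lin c d ^ i * w) (by convert hm using 1; ring)
        convert this using 1; ring)
      rwa [show n + (i + 1) = n + 1 + i by ring] at this
    · exact main _ i q hh hm he

lemma numFull_of_isFull [Infinite k] {K : Ideal (MvPolynomial (Fin 2) k)} (hf : IsFull K) : NumFull K := by
  rw [isFull_iff] at hf
  obtain ⟨z, hz0, hz, hf⟩ := hf
  obtain ⟨b, a', rfl⟩ := exists_lin hz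
  obtain ⟨a, rfl⟩ : ∃ a, a' = -a := ⟨-a', by simp⟩
  have hab : a ≠ 0 ∨ b ≠ 0 := by
    by_contra! hcon
    apply hz0
    simp [lin, hcon.1, hcon.2]
  obtain ⟨c, d, h⟩ := exists_dual hab
  have hK : ∀ v, lin b (-a) * v ∈ K → lin c d * v ∈ K := by
    intro v hv
    obtain ⟨h0, h1⟩ := hf v hv
    have := K.add_mem (K.mul_mem_left (C c) h0) (K.mul_mem_left (C d) h1)
    rw [lin]
    convert this using 1
    ring
  intro n hn
  refine le_antisymm ?_ (growth _ hn)
  obtain ⟨q, hq, hq0⟩ := Submodule.exists_mem_ne_zero_of_ne_bot hn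
  obtain ⟨p, hp, hpe⟩ := exists_nonvanishing h K hK n 0 q hq0 hq.2 (by simpa using hq.1)
  rw [add_zero] at hp
  rw [← finrank_zu h (gr K n) (u := lin c d * p) (by rwa [map_mul, eval_t h, one_mul])]
  apply Submodule.finrank_mono
  set W := mulBy (lin b (-a)) (gr K n) ⊔ Submodule.span k {lin c d * p} with hW
  have hzW : ∀ v ∈ gr K n, lin b (-a) * v ∈ W := fun v hv =>
    Submodule.mem_sup_left ⟨v, hv, rfl⟩
  have hpW : lin c d * p ∈ W :=
    Submodule.mem_sup_right (Submodule.mem_span_singleton_self _)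
  have htW : ∀ v ∈ gr K n, lin c d * v ∈ W := by
    intro v hv
    set r := eval ![a, b] v / eval ![a, b] p with hr
    have hd : v - r • p ∈ gr K n := Submodule.sub_mem _ hv (Submodule.smul_mem _ _ hp)
    have hd0 : eval ![a, b] (v - r • p) = 0 := by
      rw [map_sub, smul_eval, hr, div_mul_cancel₀ _ hpe, sub_self]
    have hex : ∃ w ∈ gr K n, lin c d * (v - r • p) = lin b (-a) * w := by
      rcases n with _ | n
      · refine ⟨0, Submodule.zero_mem _, ?_⟩
        have : v - r • p = 0 := by
          by_contra hne
          exact eval_ne_of_zero hd.2 hne _ hd0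
        rw [this]; simp
      · obtain ⟨w, hw, e⟩ := exists_factor h hd.2 hd0
        refine ⟨lin c d * w, ⟨hK w (e ▸ hd.1), ?_⟩, ?_⟩
        · rw [add_comm]; exact (lin_hom c d).mul hw
        · rw [e]; ring
    obtain ⟨w, hw, e⟩ := hex
    have : lin c d * v = lin b (-a) * w + r • (lin c d * p) := by
      rw [← e, smul_eq_C_mul, smul_eq_C_mul]; ring
    rw [this]
    exact W.add_mem (hzW w hw) (W.smul_mem _ hpW)
  have hX0 : ∀ v ∈ gr K n, X 0 * v ∈ W := by
    intro v hv
    have : X 0 * v = a • (lin c d * v) + d • (lin b (-a) * v) := by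
      rw [smul_eq_C_mul, smul_eq_C_mul]
      conv_lhs => rw [X0_eq h]
      ring
    rw [this]
    exact W.add_mem (W.smul_mem _ (htW v hv)) (W.smul_mem _ (hzW v hv))
  have hX1 : ∀ v ∈ gr K n, X 1 * v ∈ W := by
    intro v hv
    have : X 1 * v = b • (lin c d * v) - c • (lin b (-a) * v) := by
      rw [smul_eq_C_mul, smul_eq_C_mul]
      conv_lhs => rw [X1_eq h]
      ring
    rw [this]
    exact W.sub_mem (W.smul_mem _ (htW v hv)) (W.smul_mem _ (hzW v hv))
  intro u hu
  obtain ⟨v, hv, w, hw, rfl⟩ := mem_mm.1 hu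
  exact W.add_mem (hX0 v hv) (hX1 w hw)

lemma exists_gr_ne {K : Ideal (MvPolynomial (Fin 2) k)} (hK : K ≠ ⊥) (hh : IsHomogeneousIdeal K) :
    ∃ n, ∃ p ∈ K, p ≠ 0 ∧ p.IsHomogeneous n := by
  obtain ⟨p, hp, hp0⟩ := Submodule.exists_mem_ne_zero_of_ne_bot hK
  by_contra! hcon
  apply hp0
  rw [← sum_homogeneousComponent p]
  refine Finset.sum_eq_zero fun i _ => ?_
  by_contra hne
  exact hcon i _ (hh p hp i) hne (homogeneousComponent_isHomogeneous _ _)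

lemma gr_ne_bot {K : Ideal (MvPolynomial (Fin 2) k)} (hK : K ≠ ⊥) (hh : IsHomogeneousIdeal K) {n : ℕ}
    (hn : ordDeg K ≤ n) : gr K n ≠ ⊥ := by
  obtain ⟨p, hp, hp0, hph⟩ := Nat.sInf_mem (exists_gr_ne hK hh)
  change p.IsHomogeneous (ordDeg K) at hph
  rw [Submodule.ne_bot_iff]
  refine ⟨X 0 ^ (n - ordDeg K) * p, ⟨K.mul_mem_left _ hp, ?_⟩,
    mul_ne_zero (pow_ne_zero _ (X_ne_zero _)) hp0⟩
  have := (isHomogeneous_X_pow (R := k) (0 : Fin 2) (n - ordDeg K)).mul hph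
  rwa [Nat.sub_add_cancel hn] at this

lemma ordDeg_le {K : Ideal (MvPolynomial (Fin 2) k)} {n : ℕ} (hn : gr K n ≠ ⊥) : ordDeg K ≤ n := by
  obtain ⟨p, hp, hp0⟩ := Submodule.exists_mem_ne_zero_of_ne_bot hn
  exact Nat.sInf_le ⟨p, hp.1, hp0, hp.2⟩

lemma mem_of_hc {K : Ideal (MvPolynomial (Fin 2) k)} {p : MvPolynomial (Fin 2) k} (h : ∀ n, homogeneousComponent n p ∈ K) :
    p ∈ K := by
  rw [← sum_homogeneousComponent p]
  exact K.sum_mem fun i _ => h i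

lemma isFull_of_numFull [Infinite k] {K : Ideal (MvPolynomial (Fin 2) k)} (hK : K ≠ ⊥)
    (hh : IsHomogeneousIdeal K) (hN : NumFull K) : IsFull K := by
  obtain ⟨p, hp, hp0⟩ := Submodule.exists_mem_ne_zero_of_ne_bot (gr_ne_bot hK hh le_rfl)
  obtain ⟨a, b, c, d, h, he⟩ := exists_pt hp0
  rw [isFull_iff]
  refine ⟨lin b (-a), z_ne h, lin_hom _ _, ?_⟩
  have ht : ∀ v n, v.IsHomogeneous n → lin b (-a) * v ∈ K → lin c d * v ∈ K := by
    intro v n hv hzv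
    by_cases hv0 : v = 0
    · simp [hv0]
    have hzv' : lin b (-a) * v ∈ gr K (1 + n) := ⟨hzv, (lin_hom _ _).mul hv⟩
    have hne : gr K (1 + n) ≠ ⊥ :=
      (Submodule.ne_bot_iff _).2 ⟨_, hzv', mul_ne_zero (z_ne h) hv0⟩
    have hle := ordDeg_le hne
    set s := lin c d ^ (1 + n - ordDeg K) * p with hs
    have hsK : s ∈ gr K (1 + n) := by
      refine ⟨K.mul_mem_left _ hp.1, ?_⟩
      have := ((lin_hom c d).pow (1 + n - ordDeg K)).mul hp.2
      rwa [one_mul, Nat.sub_add_cancel hle] at this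
    have hse : eval ![a, b] (lin c d * s) ≠ 0 := by
      rwa [hs, map_mul, map_mul, map_pow, eval_t h, one_pow, one_mul, one_mul]
    have heq := Submodule.eq_of_le_of_finrank_eq (zu_le (a := a) (b := b) (c := c) (d := d) _ hsK)
      (by rw [finrank_zu h _ hse, hN _ hne])
    have hm : lin c d * (lin b (-a) * v) ∈ mm (gr K (1 + n)) := lin_mul_mem _ _ hzv'
    rw [← heq, Submodule.mem_sup] at hm
    obtain ⟨_, ⟨w, hw, rfl⟩, u, hu, e⟩ := hm
    obtain ⟨r, rfl⟩ := Submodule.mem_span_singleton.1 hu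
    have e' := congrArg (eval ![a, b]) e
    simp only [LinearMap.mulLeft_apply, map_add, map_mul (eval ![a, b]) (lin b (-a)), eval_z,
      zero_mul, smul_eval, zero_add, map_mul (eval ![a, b]) (lin c d) (lin b (-a) * v),
      mul_zero] at e'
    have hr : r = 0 := by
      rcases mul_eq_zero.1 e' with h | h
      · exact h
      · exact absurd h hse
    rw [hr, zero_smul, add_zero, LinearMap.mulLeft_apply] at e
    have : lin c d * v = w := by
      apply mul_left_cancel₀ (z_ne h)
      rw [e]; ring
    rw [this]; exact hw.1
  have ht' : ∀ v, lin b (-a) * v ∈ K → lin c d * v ∈ K := by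
    intro v hv
    apply mem_of_hc
    rintro (_ | n)
    · rw [hc_mul_zero (lin_hom _ _)]; exact K.zero_mem
    · rw [hc_mul (lin_hom _ _)]
      apply ht _ n (homogeneousComponent_isHomogeneous _ _)
      rw [← hc_mul (lin_hom _ _)]
      exact hh _ hv _
  intro v hv
  have h1 := ht' v hv
  constructor
  · rw [X0_eq h, add_mul, mul_assoc, mul_assoc]
    exact K.add_mem (K.mul_mem_left _ h1) (K.mul_mem_left _ hv)
  · rw [X1_eq h, sub_mul, mul_assoc, mul_assoc]
    exact K.sub_mem (K.mul_mem_left _ h1) (K.mul_mem_left _ hv)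

lemma mu_spec (K : Ideal (MvPolynomial (Fin 2) k)) :
    ∃ s : Finset (MvPolynomial (Fin 2) k), s.card = mu K ∧ Ideal.span (s : Set (MvPolynomial (Fin 2) k)) = K := by
  have hne : {n : ℕ | ∃ s : Finset (MvPolynomial (Fin 2) k), s.card = n ∧
      Ideal.span (s : Set (MvPolynomial (Fin 2) k)) = K}.Nonempty := by
    obtain ⟨s, hs⟩ := (isNoetherianRing_iff_ideal_fg (MvPolynomial (Fin 2) k)).1 inferInstance K
    exact ⟨_, s, rfl, hs⟩
  exact Nat.sInf_mem hne

lemma mu_le {K : Ideal (MvPolynomial (Fin 2) k)} {s : Finset (MvPolynomial (Fin 2) k)}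
    (hs : Ideal.span (s : Set (MvPolynomial (Fin 2) k)) = K) : mu K ≤ s.card :=
  Nat.sInf_le ⟨s, rfl, hs⟩

/-- Every element of `(s)` is a `k`-combination of `s` modulo `𝔪 (s)`. -/
lemma span_mod (K : Ideal (MvPolynomial (Fin 2) k)) (s : Set (MvPolynomial (Fin 2) k)) (hs : Ideal.span s = K)
    {u : MvPolynomial (Fin 2) k} (hu : u ∈ K) :
    (mm (K.restrictScalars k)).mkQ u ∈
      Submodule.span k ((mm (K.restrictScalars k)).mkQ '' s) := by
  set M := mm (K.restrictScalars k) with hM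
  have hdecomp : ∀ f : MvPolynomial (Fin 2) k, ∃ p q : MvPolynomial (Fin 2) k, f = C (constantCoeff f) + (X 0 * p + X 1 * q) := by
    intro f
    have h0 : f - C (constantCoeff f) ∈ maxIdeal k := by
      have : f - C (constantCoeff f) ∈ Ideal.span (X '' (Set.univ : Set (Fin 2))) := by
        rw [mem_ideal_span_X_image]
        intro m hm
        by_contra! hcon
        have : m = 0 := by ext i; simpa using hcon i (Set.mem_univ i)
        rw [this, mem_support_iff, coeff_sub, coeff_zero_C, ← constantCoeff_eq] at hm
        simp at hm
      refine Ideal.span_mono ?_ this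
      rintro _ ⟨i, _, rfl⟩
      fin_cases i <;> simp
    obtain ⟨p, q, h⟩ := Ideal.mem_span_pair.1 h0
    exact ⟨p, q, by rw [mul_comm _ p, mul_comm _ q, h]; ring⟩
  rw [← hs] at hu
  refine Submodule.span_induction (p := fun u _ => M.mkQ u ∈ Submodule.span k (M.mkQ '' s))
    ?_ ?_ ?_ ?_ hu
  · intro x hx
    exact Submodule.subset_span ⟨x, hx, rfl⟩
  · simp
  · intro x y _ _ hx hy
    rw [map_add]; exact Submodule.add_mem _ hx hy
  · intro f x hxs hx
    obtain ⟨p, q, hf⟩ := hdecomp f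
    have hxK : x ∈ K := hs ▸ hxs
    have : M.mkQ (f • x) = constantCoeff f • M.mkQ x := by
      rw [← map_smul, ← sub_eq_zero, ← map_sub, Submodule.mkQ_apply,
        Submodule.Quotient.mk_eq_zero, hM, mem_mm]
      refine ⟨p * x, K.mul_mem_left _ hxK, q * x, K.mul_mem_left _ hxK, ?_⟩
      rw [smul_eq_mul, smul_eq_C_mul]
      linear_combination -x * hf
    rw [this]
    exact Submodule.smul_mem _ _ hx

lemma exchange {K : Ideal (MvPolynomial (Fin 2) k)} (hh : IsHomogeneousIdeal K) {u : MvPolynomial (Fin 2) k} {m : ℕ}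
    (huK : u ∈ K) (hum : u.IsHomogeneous m) (hu : u ∉ mm (K.restrictScalars k)) :
    ∃ s : Finset (MvPolynomial (Fin 2) k), s.card + 1 ≤ mu K ∧
      Ideal.span (insert u (s : Set (MvPolynomial (Fin 2) k))) = K := by
  classical
  set M := mm (K.restrictScalars k) with hM
  set T : Set (MvPolynomial (Fin 2) k) := {p | p ∈ K ∧ ∃ n, p.IsHomogeneous n} with hT
  have hli : LinearIndepOn k M.mkQ {u} := by
    rw [linearIndepOn_singleton_iff, Submodule.mkQ_apply, ne_eq, Submodule.Quotient.mk_eq_zero]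
    exact hu
  obtain ⟨B, hBT, huB, hTB, hB⟩ := exists_linearIndepOn_extension (t := T) hli
    (Set.singleton_subset_iff.2 ⟨huK, m, hum⟩)
  obtain ⟨g, hgc, hg⟩ := mu_spec K
  -- B is finite, of cardinality at most `mu K`
  have hrange : Set.range (fun x : B => M.mkQ x) ≤
      Submodule.span k ((g.image M.mkQ : Finset _) : Set (MvPolynomial (Fin 2) k ⧸ M)) := by
    rintro _ ⟨x, rfl⟩
    rw [Finset.coe_image]
    exact span_mod K g hg (hBT x.2).1
  have hcard := linearIndependent_le_span' _ hB
    ((g.image M.mkQ : Finset _) : Set (MvPolynomial (Fin 2) k ⧸ M)) hrange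
  have hfin : B.Finite := by
    rw [← Set.finite_coe_iff, ← Cardinal.lt_aleph0_iff_finite]
    exact lt_of_le_of_lt hcard Cardinal.natCast_lt_aleph0
  have hBc : hfin.toFinset.card ≤ mu K := by
    have h1 : B.ncard ≤ (g.image M.mkQ).card := by
      have h2 := Cardinal.toNat_le_toNat hcard Cardinal.natCast_lt_aleph0
      rw [Cardinal.toNat_natCast] at h2
      exact h2.trans (Fintype.card_coe (g.image M.mkQ)).le
    rw [← Set.ncard_eq_toFinset_card B hfin, ← hgc]
    exact h1.trans Finset.card_image_le
  have huB' : u ∈ hfin.toFinset := by simpa using huB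
  -- graded Nakayama
  have hspan : Ideal.span B = K := by
    apply le_antisymm
    · exact Ideal.span_le.2 fun x hx => (hBT hx).1
    have hcomp : ∀ w ∈ Submodule.span k B, ∀ n, homogeneousComponent n w ∈ Ideal.span B := by
      intro w hw n
      refine Submodule.span_induction
        (p := fun w _ => homogeneousComponent n w ∈ Ideal.span B) ?_ ?_ ?_ ?_ hw
      · intro x hx
        obtain ⟨_, i, hi⟩ := hBT hx
        rw [homogeneousComponent_of_mem ((mem_homogeneousSubmodule _ _).2 hi)]
        split_ifs
        · exact Ideal.subset_span hx
        · exact Ideal.zero_mem _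
      · simp
      · intro x y _ _ hx hy
        rw [map_add]; exact Ideal.add_mem _ hx hy
      · intro r x _ hx
        rw [map_smul, smul_eq_C_mul]; exact Ideal.mul_mem_left _ _ hx
    have hnak : ∀ n, ∀ v ∈ K, v.IsHomogeneous n → v ∈ Ideal.span B := by
      intro n
      induction n with
      | zero =>
        intro v hv hvn
        have h1 := hTB ⟨v, ⟨hv, 0, hvn⟩, rfl⟩
        rw [SetLike.mem_coe, ← Submodule.map_span] at h1
        obtain ⟨w, hw, hwv⟩ := h1
        have h2 : v - w ∈ M := by
          rw [← Submodule.Quotient.mk_eq_zero, ← Submodule.mkQ_apply, map_sub, hwv, sub_self]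
        obtain ⟨p, hp, q, hq, e⟩ := mem_mm.1 h2
        have e2 := congrArg (homogeneousComponent 0) e
        rw [map_add, hc_mul_zero (isHomogeneous_X _ _), hc_mul_zero (isHomogeneous_X _ _),
          map_sub, hc_self hvn] at e2
        have : v = homogeneousComponent 0 w := by linear_combination -e2
        rw [this]
        exact hcomp w hw 0
      | succ n ih =>
        intro v hv hvn
        have h1 := hTB ⟨v, ⟨hv, n + 1, hvn⟩, rfl⟩
        rw [SetLike.mem_coe, ← Submodule.map_span] at h1
        obtain ⟨w, hw, hwv⟩ := h1
        have h2 : v - w ∈ M := by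
          rw [← Submodule.Quotient.mk_eq_zero, ← Submodule.mkQ_apply, map_sub, hwv, sub_self]
        obtain ⟨p, hp, q, hq, e⟩ := mem_mm.1 h2
        have e2 := congrArg (homogeneousComponent (n + 1)) e
        rw [map_add, hc_mul (isHomogeneous_X _ _), hc_mul (isHomogeneous_X _ _),
          map_sub, hc_self hvn] at e2
        have : v = homogeneousComponent (n + 1) w + (X 0 * homogeneousComponent n p
            + X 1 * homogeneousComponent n q) := by rw [e2]; ring
        rw [this]
        refine Ideal.add_mem _ (hcomp w hw _) (Ideal.add_mem _ ?_ ?_)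
        · exact Ideal.mul_mem_left _ _
            (ih _ (hh p hp n) (homogeneousComponent_isHomogeneous _ _))
        · exact Ideal.mul_mem_left _ _
            (ih _ (hh q hq n) (homogeneousComponent_isHomogeneous _ _))
    intro v hv
    exact mem_of_hc fun n => hnak n _ (hh v hv n) (homogeneousComponent_isHomogeneous _ _)
  refine ⟨hfin.toFinset.erase u, ?_, ?_⟩
  · rw [Finset.card_erase_add_one huB']; exact hBc
  · rw [← Finset.coe_insert, Finset.insert_erase huB', Set.Finite.coe_toFinset]
    exact hspan

lemma mem_mm_of_mu {I J : Ideal (MvPolynomial (Fin 2) k)} (hI : IsHomogeneousIdeal I)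
    (hmu : mu (I + J) = mu I + mu J) {n : ℕ} {u : MvPolynomial (Fin 2) k} (hu : u ∈ gr I (n + 1)) (huJ : u ∈ J) :
    u ∈ mm (gr I n) := by
  classical
  have h1 : u ∈ mm (I.restrictScalars k) := by
    by_contra hcon
    obtain ⟨s, hsc, hs⟩ := exchange hI hu.1 hu.2 hcon
    obtain ⟨g, hgc, hg⟩ := mu_spec J
    have hle : mu (I + J) ≤ (s ∪ g).card := by
      apply mu_le
      rw [Finset.coe_union, Ideal.span_union, hg]
      apply le_antisymm
      · refine sup_le ?_ le_sup_right
        refine le_trans ?_ le_sup_left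
        rw [← hs]
        exact Ideal.span_mono (Set.subset_insert _ _)
      · refine sup_le ?_ le_sup_right
        rw [← hs]
        refine Ideal.span_le.2 ?_
        rintro x (rfl | hx)
        · exact Ideal.mem_sup_right huJ
        · exact Ideal.mem_sup_left (Ideal.subset_span hx)
    have := Finset.card_union_le s g
    omega
  obtain ⟨p, hp, q, hq, e⟩ := mem_mm.1 h1
  rw [mem_mm]
  refine ⟨homogeneousComponent n p, ⟨hI p hp n, homogeneousComponent_isHomogeneous _ _⟩,
    homogeneousComponent n q, ⟨hI q hq n, homogeneousComponent_isHomogeneous _ _⟩, ?_⟩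
  rw [← hc_mul (isHomogeneous_X _ _), ← hc_mul (isHomogeneous_X _ _), ← map_add, e, hc_self hu.2]

lemma gr_sup {I J : Ideal (MvPolynomial (Fin 2) k)} (hI : IsHomogeneousIdeal I) (hJ : IsHomogeneousIdeal J)
    (n : ℕ) : gr (I + J) n = gr I n ⊔ gr J n := by
  apply le_antisymm
  · intro p hp
    obtain ⟨u, hu, v, hv, e⟩ := Submodule.mem_sup.1 hp.1
    rw [← hc_self hp.2, ← e, map_add]
    exact Submodule.add_mem_sup ⟨hI u hu n, homogeneousComponent_isHomogeneous _ _⟩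
      ⟨hJ v hv n, homogeneousComponent_isHomogeneous _ _⟩
  · refine sup_le ?_ ?_
    · exact fun p hp => ⟨Ideal.mem_sup_left hp.1, hp.2⟩
    · exact fun p hp => ⟨Ideal.mem_sup_right hp.1, hp.2⟩

lemma gr_inf (I J : Ideal (MvPolynomial (Fin 2) k)) (n : ℕ) : gr (I ⊓ J) n = gr I n ⊓ gr J n := by
  ext p
  simp only [Submodule.mem_inf, mem_gr]
  tauto

lemma inf_eq {I J : Ideal (MvPolynomial (Fin 2) k)} (hI : IsHomogeneousIdeal I) (hJ : IsHomogeneousIdeal J)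
    (hmu : mu (I + J) = mu I + mu J) (n : ℕ) :
    mm (gr I n) ⊓ mm (gr J n) = gr (I ⊓ J) (n + 1) := by
  rw [gr_inf]
  apply le_antisymm
  · exact inf_le_inf (mm_gr_le _ _) (mm_gr_le _ _)
  · rintro p ⟨hp, hq⟩
    exact ⟨mem_mm_of_mu hI hmu hp hq.1,
      mem_mm_of_mu hJ (by rw [add_comm J, hmu, add_comm]) hq hp.1⟩

/-- the main dimension count -/
lemma count {I J : Ideal (MvPolynomial (Fin 2) k)} (hI : IsHomogeneousIdeal I) (hJ : IsHomogeneousIdeal J)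
    (hmu : mu (I + J) = mu I + mu J) (hIN : NumFull I) (hJN : NumFull J) {n : ℕ}
    (hIn : gr I n ≠ ⊥) (hJn : gr J n ≠ ⊥) :
    Module.finrank k (mm (gr (I + J) n)) + Module.finrank k (gr (I ⊓ J) (n + 1)) =
      Module.finrank k (gr (I + J) n) + Module.finrank k (gr (I ⊓ J) n) + 2 := by
  have h1 := Submodule.finrank_sup_add_finrank_inf_eq (gr I n) (gr J n)
  have h2 := Submodule.finrank_sup_add_finrank_inf_eq (mm (gr I n)) (mm (gr J n))
  rw [inf_eq hI hJ hmu, ← mm_sup, ← gr_sup hI hJ, hIN n hIn, hJN n hJn] at h2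
  rw [← gr_sup hI hJ, ← gr_inf] at h1
  omega

theorem full_sum_iff_of_mu_additive {k : Type*} [Field k] [Infinite k]
    (I J : Ideal (MvPolynomial (Fin 2) k))
    (hI0 : I ≠ ⊥) (hItop : I ≠ ⊤) (hJ0 : J ≠ ⊥) (hJtop : J ≠ ⊤)
    (hIhom : IsHomogeneousIdeal I) (hJhom : IsHomogeneousIdeal J)
    (hIfull : IsFull I) (hJfull : IsFull J)
    (hmu : mu (I + J) = mu I + mu J) :
    IsFull (I + J) ↔ ordDeg (I ⊓ J) ≤ max (ordDeg I) (ordDeg J) + 1 := by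
  have hIN := numFull_of_isFull hIfull
  have hJN := numFull_of_isFull hJfull
  have hK0 : I + J ≠ ⊥ := fun h => hI0 (le_bot_iff.1 (h ▸ le_sup_left))
  have hKhom : IsHomogeneousIdeal (I + J) := by
    intro p hp n
    obtain ⟨u, hu, v, hv, rfl⟩ := Submodule.mem_sup.1 hp
    rw [map_add]
    exact Submodule.add_mem_sup (hIhom u hu n) (hJhom v hv n)
  have hL0 : I ⊓ J ≠ ⊥ := by
    obtain ⟨p, hp, hp0⟩ := Submodule.exists_mem_ne_zero_of_ne_bot hI0
    obtain ⟨q, hq, hq0⟩ := Submodule.exists_mem_ne_zero_of_ne_bot hJ0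
    exact (Submodule.ne_bot_iff _).2
      ⟨p * q, ⟨I.mul_mem_right _ hp, J.mul_mem_left _ hq⟩, mul_ne_zero hp0 hq0⟩
  have hLhom : IsHomogeneousIdeal (I ⊓ J) := fun p hp n => ⟨hIhom p hp.1 n, hJhom p hp.2 n⟩
  set r := max (ordDeg I) (ordDeg J) with hr
  have hIr : ∀ n, r ≤ n → gr I n ≠ ⊥ := fun n hn =>
    gr_ne_bot hI0 hIhom ((le_max_left _ _).trans hn)
  have hJr : ∀ n, r ≤ n → gr J n ≠ ⊥ := fun n hn =>
    gr_ne_bot hJ0 hJhom ((le_max_right _ _).trans hn)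
  constructor
  · intro hf
    have hKN := numFull_of_isFull hf
    have hc := count hIhom hJhom hmu hIN hJN (hIr r le_rfl) (hJr r le_rfl)
    have hne : gr (I + J) r ≠ ⊥ := by
      rw [gr_sup hIhom hJhom]
      intro h
      exact hIr r le_rfl (le_bot_iff.1 (h ▸ le_sup_left))
    rw [hKN r hne] at hc
    apply ordDeg_le
    intro hbot
    rw [hbot, finrank_bot] at hc
    omega
  · intro ho
    apply isFull_of_numFull hK0 hKhom
    intro n hne
    by_cases hIn : gr I n = ⊥
    · have e : gr (I + J) n = gr J n := by rw [gr_sup hIhom hJhom, hIn, bot_sup_eq]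
      rw [e] at hne ⊢
      exact hJN n hne
    by_cases hJn : gr J n = ⊥
    · have e : gr (I + J) n = gr I n := by rw [gr_sup hIhom hJhom, hJn, sup_bot_eq]
      rw [e] at hne ⊢
      exact hIN n hne
    have hrn : r ≤ n := max_le (ordDeg_le hIn) (ordDeg_le hJn)
    have hc := count hIhom hJhom hmu hIN hJN hIn hJn
    have hg := growth _ hne
    have hL : Module.finrank k (gr (I ⊓ J) n) + 1 ≤ Module.finrank k (gr (I ⊓ J) (n + 1)) := by
      by_cases hLn : gr (I ⊓ J) n = ⊥
      · rw [hLn, finrank_bot, zero_add, Nat.one_le_iff_ne_zero, ne_eq,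
          Submodule.finrank_eq_zero]
        exact gr_ne_bot hL0 hLhom (ho.trans (by omega))
      · exact (growth _ hLn).trans (Submodule.finrank_mono (mm_gr_le _ _))
    omega

end
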